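/- arXiv:2602.13786 — 3 statements merged into one kernel-verified Lean document; each statement's English description precedes it below -/
import Mathlib

section
/- Let f : ℝ → ℝ be continuously differentiable, let a, â be real numbers with â ≠ a, and set τ̃(â, a) := (â − a)⁻² · ∫_{â}^{a} (f(s) − f(a)) ds. For any ε > 0, if τ_f := (1/2) · sup_{s ∈ J(â,a)} |f'(s)| + ε, then τ_f − τ̃(â, a) ≥ ε and τ_f + τ̃(â, a) ≥ ε. -/
/-- If `|f s - f v| ≤ C |s - v|` on the interval between `u` and `v`, then the integral of
`f - f v` over it is at most `C / 2 * (u - v) ^ 2` in absolute value. -/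
theorem abs_intervalIntegral_sub_le_of_abs_sub_le {f : ℝ → ℝ} {u v C : ℝ}
    (h : ∀ s ∈ Set.uIcc u v, |f s - f v| ≤ C * |s - v|) :
    |∫ s in u..v, (f s - f v)| ≤ C / 2 * (u - v) ^ 2 := by
  have hsubst : ∫ s in u..v, (f s - f v) =
      (v - u) * ∫ t in (0 : ℝ)..1, (f (u + (v - u) * t) - f v) := by
    simpa using (intervalIntegral.mul_integral_comp_add_mul (a := 0) (b := 1)
      (f := fun s => f s - f v) (v - u) u).symm
  have hbound : |∫ t in (0 : ℝ)..1, (f (u + (v - u) * t) - f v)| ≤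
      ∫ t in (0 : ℝ)..1, C * |u - v| * (1 - t) := by
    rw [← Real.norm_eq_abs]
    refine intervalIntegral.norm_integral_le_of_norm_le zero_le_one ?_
      (Continuous.intervalIntegrable (by fun_prop) _ _)
    refine Filter.Eventually.of_forall fun t ht => ?_
    have hmem : u + (v - u) * t ∈ Set.uIcc u v := by
      rw [← segment_eq_uIcc, segment_eq_image']
      exact ⟨t, ⟨ht.1.le, ht.2⟩, by simp [mul_comm]⟩
    calc ‖f (u + (v - u) * t) - f v‖ ≤ C * |u + (v - u) * t - v| := h _ hmem
      _ = C * |(u - v) * (1 - t)| := by ring_nf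
      _ = C * |u - v| * (1 - t) := by
        rw [abs_mul, abs_of_nonneg (sub_nonneg.2 ht.2), mul_assoc]
  have hval : ∫ t in (0 : ℝ)..1, C * |u - v| * (1 - t) = C * |u - v| / 2 := by
    rw [intervalIntegral.integral_const_mul, intervalIntegral.integral_sub (by simp) (by simp)]
    norm_num
    ring
  rw [hsubst, abs_mul, abs_sub_comm v u]
  calc |u - v| * |∫ t in (0 : ℝ)..1, (f (u + (v - u) * t) - f v)|
      ≤ |u - v| * (C * |u - v| / 2) := by
        gcongr
        exact hbound.trans_eq hval
    _ = C / 2 * |u - v| ^ 2 := by ring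
    _ = C / 2 * (u - v) ^ 2 := by rw [sq_abs]

/-- The choice `τ_f = (1/2)·sup_{J(ahat,a)}|f'| + ε` of the penalty parameter dominates the
nonlinear stabilization function `τ̃(ahat, a) = (ahat − a)⁻² · ∫_{ahat}^{a} (f(s) − f(a)) ds`:
both `τ_f − τ̃ ≥ ε` and `τ_f + τ̃ ≥ ε` hold. -/
theorem penalty_dominates_stab_function (f : ℝ → ℝ) (hf : ContDiff ℝ 1 f)
    (a ahat : ℝ) (hne : ahat ≠ a) (ε : ℝ) (hε : 0 < ε) :
    ε ≤ ((1 / 2) * sSup ((fun s => |deriv f s|) '' Set.uIcc ahat a) + ε)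
        - ((ahat - a) ^ 2)⁻¹ * (∫ s in ahat..a, (f s - f a)) ∧
    ε ≤ ((1 / 2) * sSup ((fun s => |deriv f s|) '' Set.uIcc ahat a) + ε)
        + ((ahat - a) ^ 2)⁻¹ * (∫ s in ahat..a, (f s - f a)) := by
  set C := sSup ((fun s => |deriv f s|) '' Set.uIcc ahat a)
  have hbdd : BddAbove ((fun s => |deriv f s|) '' Set.uIcc ahat a) :=
    isCompact_uIcc.bddAbove_image (hf.continuous_deriv le_rfl).abs.continuousOn
  have hlip : ∀ s ∈ Set.uIcc ahat a, |f s - f a| ≤ C * |s - a| := fun s hs =>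
    (convex_uIcc ahat a).norm_image_sub_le_of_norm_deriv_le
      (fun x _ => (hf.differentiable one_ne_zero) x)
      (fun x hx => le_csSup hbdd ⟨x, hx, rfl⟩) Set.right_mem_uIcc hs
  have hpos : 0 < (ahat - a) ^ 2 := sq_pos_of_ne_zero (sub_ne_zero.2 hne)
  have key : |((ahat - a) ^ 2)⁻¹ * ∫ s in ahat..a, (f s - f a)| ≤ 1 / 2 * C := by
    rw [abs_mul, abs_of_pos (inv_pos.2 hpos), inv_mul_le_iff₀ hpos]
    linarith [abs_intervalIntegral_sub_le_of_abs_sub_le hlip]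
  obtain ⟨h₁, h₂⟩ := abs_le.1 key
  constructor <;> linarith
end

section
/- Let E be a real Banach space, let t₀ < t₁ be real numbers, set Δt := t₁ − t₀, let θ ∈ [0,1], and set t_* := t₀ + θ·Δt. If f : ℝ → E is twice continuously differentiable on [t₀, t₁], then ‖(f(t₁) − f(t₀))/Δt − f'(t_*)‖ ≤ Δt^{1/2} · (∫_{t₀}^{t₁} ‖f''(s)‖² ds)^{1/2}. -/
open MeasureTheory in
/-- Cauchy–Schwarz on an interval, with the constant function `1` as second factor. -/
theorem sq_intervalIntegral_le_mul_intervalIntegral_sq {a b : ℝ} (hab : a ≤ b) {h : ℝ → ℝ}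
    (hc : ContinuousOn h (Set.Icc a b)) :
    (∫ s in a..b, h s) ^ 2 ≤ (b - a) * ∫ s in a..b, h s ^ 2 := by
  rcases hab.eq_or_lt with rfl | hlt
  · simp
  have hc' : ContinuousOn h (Set.uIcc a b) := by rwa [Set.uIcc_of_le hab]
  have hi : IntervalIntegrable h volume a b := hc'.intervalIntegrable
  have hi2 : IntervalIntegrable (fun s => h s ^ 2) volume a b := (hc'.pow 2).intervalIntegrable
  set M := ∫ s in a..b, h s with hM
  have key : 0 ≤ ∫ s in a..b, ((b - a) * h s - M) ^ 2 :=
    intervalIntegral.integral_nonneg hab fun s _ => sq_nonneg _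
  have expand : ∫ s in a..b, ((b - a) * h s - M) ^ 2
      = (b - a) * ((b - a) * (∫ s in a..b, h s ^ 2) - M ^ 2) := by
    have : ∀ s, ((b - a) * h s - M) ^ 2
        = (b - a) ^ 2 * h s ^ 2 - 2 * (b - a) * M * h s + M ^ 2 := fun s => by ring
    simp only [this]
    rw [intervalIntegral.integral_add ((hi2.const_mul _).sub (hi.const_mul _))
      intervalIntegrable_const, intervalIntegral.integral_sub (hi2.const_mul _) (hi.const_mul _),
      intervalIntegral.integral_const_mul, intervalIntegral.integral_const_mul,
      intervalIntegral.integral_const, ← hM, smul_eq_mul]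
    ring
  rw [expand] at key
  have := nonneg_of_mul_nonneg_right key (sub_pos.2 hlt)
  linarith

open MeasureTheory in
/-- The increment of a `C¹` function between two points of `[a, b]` is at most the total
variation `∫ ‖g'‖` over `[a, b]`. -/
theorem ContDiffOn.norm_sub_le_integral_norm_derivWithin
    {E : Type*} [NormedAddCommGroup E] [NormedSpace ℝ E] [CompleteSpace E]
    {a b : ℝ} (hab : a < b) {g : ℝ → E} (hg : ContDiffOn ℝ 1 g (Set.Icc a b))
    {x y : ℝ} (hx : x ∈ Set.Icc a b) (hy : y ∈ Set.Icc a b) :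
    ‖g y - g x‖ ≤ ∫ s in a..b, ‖derivWithin g (Set.Icc a b) s‖ := by
  wlog hxy : x ≤ y generalizing x y
  · rw [norm_sub_rev]
    exact this hy hx (le_of_not_ge hxy)
  have hc : ContinuousOn (derivWithin g (Set.Icc a b)) (Set.Icc a b) :=
    hg.continuousOn_derivWithin (uniqueDiffOn_Icc hab) le_rfl
  have hsub : Set.Icc x y ⊆ Set.Icc a b := Set.Icc_subset_Icc hx.1 hy.2
  have ftc : ∫ s in x..y, derivWithin g (Set.Icc a b) s = g y - g x := by
    refine intervalIntegral.integral_eq_sub_of_hasDerivAt_of_le hxy (hg.continuousOn.mono hsub)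
      (fun s hs => ?_) (ContinuousOn.intervalIntegrable_of_Icc hxy (hc.mono hsub))
    have hs' : s ∈ Set.Ioo a b := Set.Ioo_subset_Ioo hx.1 hy.2 hs
    exact ((hg.differentiableOn one_ne_zero) s
      (Set.Ioo_subset_Icc_self hs')).hasDerivWithinAt.hasDerivAt (Icc_mem_nhds hs'.1 hs'.2)
  rw [← ftc]
  refine (intervalIntegral.norm_integral_le_integral_norm hxy).trans ?_
  exact intervalIntegral.integral_mono_interval hx.1 hxy hy.2
    (Filter.Eventually.of_forall fun s => norm_nonneg _)
    (ContinuousOn.intervalIntegrable_of_Icc hab.le hc.norm)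

/-- First-order time remainder bound for the implicit θ-scheme: if `f` is twice continuously
differentiable on `[t₀, t₁]`, `Δt = t₁ − t₀` and `t_* = t₀ + θ·Δt` with `θ ∈ [0,1]`, then
`‖(f(t₁) − f(t₀))/Δt − f'(t_*)‖ ≤ Δt^{1/2} · (∫_{t₀}^{t₁} ‖f''(s)‖² ds)^{1/2}`. -/
theorem theta_scheme_time_remainder_first_order
    {E : Type*} [NormedAddCommGroup E] [NormedSpace ℝ E] [CompleteSpace E]
    (t₀ t₁ : ℝ) (ht : t₀ < t₁) (θ : ℝ) (hθ : θ ∈ Set.Icc (0 : ℝ) 1)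
    (f : ℝ → E) (hf : ContDiffOn ℝ 2 f (Set.Icc t₀ t₁)) :
    ‖(t₁ - t₀)⁻¹ • (f t₁ - f t₀)
        - derivWithin f (Set.Icc t₀ t₁) (t₀ + θ * (t₁ - t₀))‖
      ≤ (t₁ - t₀) ^ ((1 : ℝ) / 2)
          * (∫ s in t₀..t₁,
              ‖derivWithin (derivWithin f (Set.Icc t₀ t₁)) (Set.Icc t₀ t₁) s‖ ^ 2)
            ^ ((1 : ℝ) / 2) := by
  have hΔ : 0 < t₁ - t₀ := sub_pos.2 ht
  have hU := uniqueDiffOn_Icc ht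
  have hc : t₀ + θ * (t₁ - t₀) ∈ Set.Icc t₀ t₁ := by
    constructor <;> nlinarith [hθ.1, hθ.2]
  set c := t₀ + θ * (t₁ - t₀)
  have hf' : ContDiffOn ℝ 1 (derivWithin f (Set.Icc t₀ t₁)) (Set.Icc t₀ t₁) :=
    hf.derivWithin hU (by norm_num)
  have hf'' := hf'.continuousOn_derivWithin hU le_rfl
  set f' := derivWithin f (Set.Icc t₀ t₁)
  set M := ∫ s in t₀..t₁, ‖derivWithin f' (Set.Icc t₀ t₁) s‖
  have hder : ∀ x ∈ Set.Icc t₀ t₁,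
      HasDerivWithinAt (fun x => f x - x • f' c) (f' x - f' c) (Set.Icc t₀ t₁) x := by
    intro x hx
    have h1 := ((hf.differentiableOn two_ne_zero) x hx).hasDerivWithinAt
    have h2 := (hasDerivWithinAt_id x (Set.Icc t₀ t₁)).smul_const (f' c)
    rw [one_smul] at h2
    exact h1.sub h2
  have hmv := (convex_Icc t₀ t₁).norm_image_sub_le_of_norm_hasDerivWithin_le hder
    (fun x hx => hf'.norm_sub_le_integral_norm_derivWithin ht hc hx)
    (Set.left_mem_Icc.2 ht.le) (Set.right_mem_Icc.2 ht.le)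
  rw [Real.norm_of_nonneg hΔ.le] at hmv
  have heq : (t₁ - t₀)⁻¹ • (f t₁ - f t₀) - f' c
      = (t₁ - t₀)⁻¹ • (f t₁ - t₁ • f' c - (f t₀ - t₀ • f' c)) := by
    have : f t₁ - t₁ • f' c - (f t₀ - t₀ • f' c) = (f t₁ - f t₀) - (t₁ - t₀) • f' c := by
      rw [sub_smul]; abel
    rw [this, smul_sub _ (f t₁ - f t₀), inv_smul_smul₀ hΔ.ne']
  have hM : ‖(t₁ - t₀)⁻¹ • (f t₁ - f t₀) - f' c‖ ≤ M := by
    rw [heq, norm_smul, norm_inv, Real.norm_of_nonneg hΔ.le, inv_mul_le_iff₀ hΔ, mul_comm]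
    exact hmv
  rw [← Real.sqrt_eq_rpow, ← Real.sqrt_eq_rpow, ← Real.sqrt_mul hΔ.le]
  exact hM.trans (Real.le_sqrt_of_sq_le
    (sq_intervalIntegral_le_mul_intervalIntegral_sq ht.le hf''.norm))
end

section
/- Let E be a real Banach space, let t₀ < t₁ be real numbers, set Δt := t₁ − t₀, let θ ∈ [0,1], and set t_* := t₀ + θ·Δt. If f : ℝ → E is twice continuously differentiable on [t₀, t₁], then ‖(1−θ)·f(t₀) + θ·f(t₁) − f(t_*)‖ ≤ Δt^{3/2} · (∫_{t₀}^{t₁} ‖f''(s)‖² ds)^{1/2}. -/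
open Set MeasureTheory in
/-- Cauchy–Schwarz inequality against the constant function `1` on an interval. -/
theorem sq_intervalIntegral_le {a b : ℝ} (hab : a < b) {u : ℝ → ℝ}
    (hu : IntervalIntegrable u volume a b)
    (hu2 : IntervalIntegrable (fun s => u s ^ 2) volume a b) :
    (∫ s in a..b, u s) ^ 2 ≤ (b - a) * ∫ s in a..b, u s ^ 2 := by
  set A := ∫ s in a..b, u s with hA
  have hd : 0 < b - a := sub_pos.2 hab
  set c := A / (b - a) with hc
  have hcA : c * (b - a) = A := div_mul_cancel₀ _ hd.ne'
  have h0 : 0 ≤ ∫ s in a..b, (u s - c) ^ 2 :=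
    intervalIntegral.integral_nonneg hab.le fun _ _ => sq_nonneg _
  have h1 : ∫ s in a..b, (u s - c) ^ 2
      = (∫ s in a..b, u s ^ 2) - 2 * c * A + (b - a) * c ^ 2 := by
    have : ∀ s, (u s - c) ^ 2 = u s ^ 2 - 2 * c * u s + c ^ 2 := fun s => by ring
    simp_rw [this]
    rw [intervalIntegral.integral_add (hu2.sub (hu.const_mul _)) intervalIntegrable_const,
      intervalIntegral.integral_sub hu2 (hu.const_mul _),
      intervalIntegral.integral_const_mul, intervalIntegral.integral_const, smul_eq_mul]
  rw [h1] at h0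
  have h2 := mul_nonneg hd.le h0
  rw [← hcA] at h2 ⊢
  nlinarith

open Set MeasureTheory in
/-- The oscillation of a function is bounded by the integral of the norm of its derivative. -/
theorem norm_sub_le_integral_norm_of_hasDerivWithinAt
    {E : Type*} [NormedAddCommGroup E] [NormedSpace ℝ E] [CompleteSpace E]
    {a b : ℝ} {g g' : ℝ → E} (hg : ∀ x ∈ Icc a b, HasDerivWithinAt g (g' x) (Icc a b) x)
    (hg' : ContinuousOn g' (Icc a b)) {r s : ℝ} (hr : r ∈ Icc a b) (hs : s ∈ Icc a b) :
    ‖g s - g r‖ ≤ ∫ x in a..b, ‖g' x‖ := by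
  wlog hrs : r ≤ s generalizing r s
  · rw [norm_sub_rev]
    exact this hs hr (le_of_not_ge hrs)
  have hsub : Icc r s ⊆ Icc a b := Icc_subset_Icc hr.1 hs.2
  have hab : a ≤ b := hr.1.trans hr.2
  have hint : IntervalIntegrable g' volume r s :=
    (hg'.mono hsub).intervalIntegrable_of_Icc hrs
  rw [← intervalIntegral.integral_eq_sub_of_hasDerivAt_of_le hrs
    (fun x hx => ((hg x (hsub hx)).continuousWithinAt.mono hsub))
    (fun x hx => (hg x (hsub (Ioo_subset_Icc_self hx))).hasDerivAt
      (Icc_mem_nhds (hr.1.trans_lt hx.1) (hx.2.trans_le hs.2))) hint]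
  refine (intervalIntegral.norm_integral_le_integral_norm hrs).trans ?_
  exact intervalIntegral.integral_mono_interval hr.1 hrs hs.2
    (Filter.Eventually.of_forall fun _ => norm_nonneg _)
    (hg'.norm.intervalIntegrable_of_Icc hab)

open Set in
/-- First-order Taylor bound when the derivative stays within `A` of its value at `c`. -/
theorem norm_sub_sub_smul_le_of_norm_deriv_sub_le
    {E : Type*} [NormedAddCommGroup E] [NormedSpace ℝ E]
    {S : Set ℝ} (hS : Convex ℝ S) {f g : ℝ → E} {A c t : ℝ}
    (hf : ∀ x ∈ S, HasDerivWithinAt f (g x) S x)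
    (hA : ∀ x ∈ S, ‖g x - g c‖ ≤ A) (hc : c ∈ S) (ht : t ∈ S) :
    ‖f t - f c - (t - c) • g c‖ ≤ A * |t - c| := by
  have h := hS.norm_image_sub_le_of_norm_hasDerivWithin_le
    (f := fun x => f x - x • g c) (f' := fun x => g x - g c)
    (fun x hx => by
      simpa only [id_eq, one_smul] using
        (hf x hx).fun_sub ((hasDerivWithinAt_id x S).smul_const (g c))) hA hc ht
  rw [Real.norm_eq_abs] at h
  convert h using 2
  module


/-- Intermediate-time mismatch bound for the implicit θ-scheme: if `f` is twice continuously
differentiable on `[t₀, t₁]`, `Δt = t₁ − t₀` and `t_* = t₀ + θ·Δt` with `θ ∈ [0,1]`, then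
`‖(1−θ)·f(t₀) + θ·f(t₁) − f(t_*)‖ ≤ Δt^{3/2} · (∫_{t₀}^{t₁} ‖f''(s)‖² ds)^{1/2}`. -/
theorem theta_scheme_intermediate_mismatch
    {E : Type*} [NormedAddCommGroup E] [NormedSpace ℝ E] [CompleteSpace E]
    (t₀ t₁ : ℝ) (ht : t₀ < t₁) (θ : ℝ) (hθ : θ ∈ Set.Icc (0 : ℝ) 1)
    (f : ℝ → E) (hf : ContDiffOn ℝ 2 f (Set.Icc t₀ t₁)) :
    ‖(1 - θ) • f t₀ + θ • f t₁ - f (t₀ + θ * (t₁ - t₀))‖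
      ≤ (t₁ - t₀) ^ ((3 : ℝ) / 2)
          * (∫ s in t₀..t₁,
              ‖derivWithin (derivWithin f (Set.Icc t₀ t₁)) (Set.Icc t₀ t₁) s‖ ^ 2)
            ^ ((1 : ℝ) / 2) := by
  obtain ⟨hθ0, hθ1⟩ := hθ
  have hd : 0 < t₁ - t₀ := sub_pos.2 ht
  have hU : UniqueDiffOn ℝ (Set.Icc t₀ t₁) := uniqueDiffOn_Icc ht
  set g := derivWithin f (Set.Icc t₀ t₁)
  set g' := derivWithin g (Set.Icc t₀ t₁)
  have hgC : ContDiffOn ℝ 1 g (Set.Icc t₀ t₁) := hf.derivWithin hU (by norm_num)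
  have hg'C : ContinuousOn g' (Set.Icc t₀ t₁) := hgC.continuousOn_derivWithin hU le_rfl
  have hfd : ∀ x ∈ Set.Icc t₀ t₁, HasDerivWithinAt f (g x) (Set.Icc t₀ t₁) x := fun x hx =>
    (hf.differentiableOn (by norm_num) x hx).hasDerivWithinAt
  have hgd : ∀ x ∈ Set.Icc t₀ t₁, HasDerivWithinAt g (g' x) (Set.Icc t₀ t₁) x := fun x hx =>
    (hgC.differentiableOn (by norm_num) x hx).hasDerivWithinAt
  set A := ∫ s in t₀..t₁, ‖g' s‖
  set I := ∫ s in t₀..t₁, ‖g' s‖ ^ 2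
  have hA0 : 0 ≤ A := intervalIntegral.integral_nonneg ht.le fun _ _ => norm_nonneg _
  have hI0 : 0 ≤ I := intervalIntegral.integral_nonneg ht.le fun _ _ => sq_nonneg _
  have hAI : A ^ 2 ≤ (t₁ - t₀) * I :=
    sq_intervalIntegral_le ht (hg'C.norm.intervalIntegrable_of_Icc ht.le)
      ((hg'C.norm.pow 2).intervalIntegrable_of_Icc ht.le)
  set c := t₀ + θ * (t₁ - t₀) with hc
  have hcm : c ∈ Set.Icc t₀ t₁ := ⟨by nlinarith, by nlinarith⟩
  have hosc : ∀ x ∈ Set.Icc t₀ t₁, ‖g x - g c‖ ≤ A := fun x hx =>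
    norm_sub_le_integral_norm_of_hasDerivWithinAt hgd hg'C hcm hx
  have h0 := norm_sub_sub_smul_le_of_norm_deriv_sub_le (convex_Icc t₀ t₁) hfd hosc hcm
    (Set.left_mem_Icc.2 ht.le)
  have h1 := norm_sub_sub_smul_le_of_norm_deriv_sub_le (convex_Icc t₀ t₁) hfd hosc hcm
    (Set.right_mem_Icc.2 ht.le)
  rw [abs_of_nonpos (sub_nonpos.2 hcm.1)] at h0
  rw [abs_of_nonneg (sub_nonneg.2 hcm.2)] at h1
  have hsplit : (1 - θ) • f t₀ + θ • f t₁ - f c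
      = (1 - θ) • (f t₀ - f c - (t₀ - c) • g c) + θ • (f t₁ - f c - (t₁ - c) • g c) := by
    rw [hc]
    module
  calc ‖(1 - θ) • f t₀ + θ • f t₁ - f c‖
      ≤ (1 - θ) * ‖f t₀ - f c - (t₀ - c) • g c‖ + θ * ‖f t₁ - f c - (t₁ - c) • g c‖ := by
        rw [hsplit]
        refine (norm_add_le _ _).trans_eq ?_
        rw [norm_smul, norm_smul, Real.norm_of_nonneg (sub_nonneg.2 hθ1), Real.norm_of_nonneg hθ0]
    _ ≤ (1 - θ) * (A * -(t₀ - c)) + θ * (A * (t₁ - c)) := by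
        have := sub_nonneg.2 hθ1
        gcongr
    _ = 2 * θ * (1 - θ) * ((t₁ - t₀) * A) := by rw [hc]; ring
    _ ≤ (t₁ - t₀) * A := by
        refine mul_le_of_le_one_left (by positivity) ?_
        nlinarith [sq_nonneg (2 * θ - 1)]
    _ ≤ (t₁ - t₀) * ((t₁ - t₀) * I) ^ ((1 : ℝ) / 2) := by
        rw [← Real.sqrt_eq_rpow]
        exact mul_le_mul_of_nonneg_left (Real.le_sqrt_of_sq_le hAI) hd.le
    _ = (t₁ - t₀) ^ ((3 : ℝ) / 2) * I ^ ((1 : ℝ) / 2) := by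
        rw [Real.mul_rpow hd.le hI0, ← mul_assoc, show (3 : ℝ) / 2 = 1 + 1 / 2 by norm_num,
          Real.rpow_add hd, Real.rpow_one]
end
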